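/- arXiv:1910.09416 — 2 statements merged into one kernel-verified Lean document; each statement's English description precedes it below -/
import Mathlib

section
/- Fix a real number β with 1/2 < β < 1. For each positive integer n, let k := 2⌊βn/2⌋ and define the vector x* ∈ ℝ^n by x*_k := [1 + 2(k/n + 1/n)² − 2(k/n + 1/n) − 1/n] / [ binom(n,k) · 2(k/n) · (2k/n − 1 + (1/n)(2k/n + 2/n − 1)) ], x*_{k+1} := (1 − k/n) / [ binom(n,k+1) · (2k/n − 1 + (1/n)(2k/n + 2/n − 1)) ], and x*_j := 0 for all j ∉ {k, k+1}. Then there exists a positive integer N such that for all n ≥ N: x*_j ≥ 0 for every j ∈ {1,...,n}, and \sum_{j=1}^{n} [K_j^{(n)}(1) − K_j^{(n)}(i)] x*_j ≥ −1 for every i ∈ {2,...,n}. -/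
/-- Generalized binomial coefficient `C(y,j) = y(y-1)⋯(y-j+1)/j!`. -/
noncomputable def genChoose (y : ℝ) (j : ℕ) : ℝ :=
  (∏ i ∈ Finset.range j, (y - i)) / (Nat.factorial j)

/-- The Krawtchouk polynomial `K_k^{(n)}(x)`. -/
noncomputable def kraw (n k : ℕ) (x : ℝ) : ℝ :=
  ∑ j ∈ Finset.range (k + 1), (-1 : ℝ) ^ j * genChoose x j * genChoose ((n : ℝ) - x) (k - j)

/-- The 2-sparse candidate dual solution `x*` (as a function of `n`),
supported on `{k, k+1}` with `k = 2⌊βn/2⌋`. -/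
noncomputable def xStar (β : ℝ) (n : ℕ) : ℕ → ℝ := fun j =>
  let k : ℕ := 2 * ⌊β * n / 2⌋₊
  if j = k then
    (1 + 2 * ((k : ℝ) / n + 1 / n) ^ 2 - 2 * ((k : ℝ) / n + 1 / n) - 1 / n) /
      ((n.choose k : ℝ) * 2 * ((k : ℝ) / n) *
        (2 * ((k : ℝ) / n) - 1 + (1 / n) * (2 * ((k : ℝ) / n) + 2 * (1 / n) - 1)))
  else if j = k + 1 then
    (1 - (k : ℝ) / n) /
      ((n.choose (k + 1) : ℝ) *
        (2 * ((k : ℝ) / n) - 1 + (1 / n) * (2 * ((k : ℝ) / n) + 2 * (1 / n) - 1)))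
  else 0

section KrawGen

open Polynomial

/-- The generating polynomial `(1 - X)^i (1 + X)^(n - i)` of the Krawtchouk values at `i`. -/
noncomputable def krawGen (n i : ℕ) : ℝ[X] := (1 - X) ^ i * (1 + X) ^ (n - i)

theorem genChoose_natCast (m j : ℕ) : genChoose (m : ℝ) j = (m.choose j : ℝ) := by
  have h : ∏ i ∈ Finset.range j, ((m : ℝ) - i) = (m.descFactorial j : ℝ) := by
    induction j with
    | zero => simp
    | succ j ih =>
      rw [Finset.prod_range_succ, ih, Nat.descFactorial_succ]
      rcases le_or_gt j m with hj | hj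
      · push_cast [Nat.cast_sub hj]; ring
      · simp [Nat.descFactorial_eq_zero_iff_lt.2 hj]
  rw [genChoose, h, div_eq_iff (by positivity), Nat.descFactorial_eq_factorial_mul_choose]
  push_cast
  ring

theorem coeff_comp_neg_X (p : ℝ[X]) (j : ℕ) : (p.comp (-X)).coeff j = (-1) ^ j * p.coeff j := by
  rw [show (-X : ℝ[X]) = C (-1) * X by simp, comp_C_mul_X_coeff, mul_comm]

theorem coeff_one_sub_X_pow_eq (i j : ℕ) :
    ((1 - X : ℝ[X]) ^ i).coeff j = (-1) ^ j * (i.choose j : ℝ) := by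
  have h : (1 - X : ℝ[X]) ^ i = ((1 + X : ℝ[X]) ^ i).comp (-X) := by
    simp [sub_eq_add_neg]
  rw [h, coeff_comp_neg_X, coeff_one_add_X_pow]

theorem kraw_eq_coeff {n i : ℕ} (j : ℕ) (hi : i ≤ n) :
    kraw n j (i : ℝ) = (krawGen n i).coeff j := by
  rw [kraw, krawGen, coeff_mul, Finset.Nat.sum_antidiagonal_eq_sum_range_succ_mk]
  refine Finset.sum_congr rfl fun l _ => ?_
  rw [← Nat.cast_sub hi, genChoose_natCast, genChoose_natCast, coeff_one_sub_X_pow_eq,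
    coeff_one_add_X_pow]

theorem coeff_X_mul_derivative (p : ℝ[X]) (j : ℕ) :
    (X * derivative p).coeff j = j * p.coeff j := by
  cases j with
  | zero => simp
  | succ j => rw [coeff_X_mul, coeff_derivative]; push_cast; ring

theorem krawGen_coeff_zero (n j : ℕ) : (krawGen n 0).coeff j = n.choose j := by
  simp [krawGen, coeff_one_add_X_pow]

theorem krawGen_coeff_one {n : ℕ} (hn : 1 ≤ n) (j : ℕ) :
    n * (krawGen n 1).coeff j = (n - 2 * j) * (n.choose j : ℝ) := by
  obtain ⟨m, rfl⟩ := Nat.exists_eq_add_of_le' hn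
  have h : C ((m : ℝ) + 1) * krawGen (m + 1) 1 =
      C ((m : ℝ) + 1) * krawGen (m + 1) 0 - C 2 * (X * derivative (krawGen (m + 1) 0)) := by
    simp only [krawGen, derivative_pow, derivative_mul, derivative_sub, derivative_add,
      derivative_one, derivative_X]
    simp [show (C 2 : ℝ[X]) = 2 from rfl]
    ring
  have := congrArg (fun p => coeff p j) h
  simp only [coeff_sub, coeff_C_mul, coeff_X_mul_derivative, krawGen_coeff_zero] at this
  push_cast
  linarith

theorem krawGen_coeff_add_two {n i : ℕ} (hi : i + 2 ≤ n) (j : ℕ) :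
    (n - (i + 1)) * (krawGen n (i + 2)).coeff j =
      (n - 2 * j) * (krawGen n (i + 1)).coeff j - (i + 1) * (krawGen n i).coeff j := by
  obtain ⟨m, rfl⟩ := Nat.exists_eq_add_of_le' hi
  have h : C ((m : ℝ) + 1) * krawGen (m + (i + 2)) (i + 2) =
      C ((m : ℝ) + (i + 2)) * krawGen (m + (i + 2)) (i + 1)
        - C 2 * (X * derivative (krawGen (m + (i + 2)) (i + 1)))
        - C ((i : ℝ) + 1) * krawGen (m + (i + 2)) i := by
    rw [krawGen, krawGen, krawGen, show m + (i + 2) - (i + 2) = m by omega,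
      show m + (i + 2) - (i + 1) = m + 1 by omega, show m + (i + 2) - i = m + 2 by omega]
    simp [derivative_pow, show (C 2 : ℝ[X]) = 2 from rfl]
    ring
  have := congrArg (fun p => coeff p j) h
  simp only [coeff_sub, coeff_C_mul, coeff_X_mul_derivative] at this
  push_cast
  linarith

theorem krawGen_coeff_sub {n i : ℕ} (hi : i ≤ n) (j : ℕ) :
    (krawGen n (n - i)).coeff j = (-1) ^ j * (krawGen n i).coeff j := by
  have h : krawGen n (n - i) = (krawGen n i).comp (-X) := by
    rw [krawGen, krawGen, Nat.sub_sub_self hi]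
    simp [sub_eq_add_neg, mul_comm]
  rw [h, coeff_comp_neg_X]

theorem krawGen_coeff_add_two_add_two {n i : ℕ} (hi : i ≤ n) (j : ℕ) :
    (krawGen (n + 2) (i + 1)).coeff (j + 2) =
      (krawGen n i).coeff (j + 2) - (krawGen n i).coeff j := by
  have h : krawGen (n + 2) (i + 1) = krawGen n i - krawGen n i * X ^ 2 := by
    rw [krawGen, krawGen, show n + 2 - (i + 1) = n - i + 1 by omega]
    ring
  rw [h, coeff_sub, coeff_mul_X_pow]

theorem choose_add_choose_add_two_le {δ : ℝ} {n j : ℕ} (hδ : 0 ≤ δ)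
    (h1 : δ * (n + 2) ≤ j + 2) (h2 : δ * (n + 2) + j ≤ n) :
    (n.choose (j + 2) : ℝ) + n.choose j ≤ (1 - 2 * δ ^ 2) * (n + 2).choose (j + 2) := by
  have e1 : ((n + 2).choose (j + 2) : ℝ) =
      n.choose j + 2 * n.choose (j + 1) + n.choose (j + 2) := by
    have : (n + 2).choose (j + 2) = n.choose j + 2 * n.choose (j + 1) + n.choose (j + 2) := by
      rw [Nat.choose_succ_succ, Nat.choose_succ_succ n j, Nat.choose_succ_succ n (j + 1)]; ring
    exact_mod_cast this
  have hjn : j ≤ n := by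
    have : (j : ℝ) ≤ n := le_trans (by nlinarith [Nat.cast_nonneg (α := ℝ) n]) h2
    exact_mod_cast this
  have e2 : ((n : ℝ) + 2) * (n + 1) * n.choose (j + 1) =
      (n + 2).choose (j + 2) * (j + 2) * (n - j) := by
    have a1 := Nat.add_one_mul_choose_eq (n + 1) (j + 1)
    have a2 := Nat.choose_mul_succ_eq n (j + 1)
    rw [show n + 1 - (j + 1) = n - j by omega] at a2
    zify [hjn] at a1 a2
    have a1' : ((n : ℝ) + 1 + 1) * (n + 1).choose (j + 1) =
      (n + 2).choose (j + 2) * (j + 1 + 1) := by exact_mod_cast a1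
    have a2' : (n.choose (j + 1) : ℝ) * (n + 1) = (n + 1).choose (j + 1) * (n - j) := by
      exact_mod_cast a2
    linear_combination ((n : ℝ) + 2) * a2' + (n - j : ℝ) * a1'
  have hn : (0 : ℝ) ≤ n := Nat.cast_nonneg n
  have hj : (0 : ℝ) ≤ j := Nat.cast_nonneg j
  have e3 : δ ^ 2 * (((n : ℝ) + 2) * (n + 1)) ≤ (j + 2) * (n - j) := by
    have := mul_le_mul h1 (le_sub_iff_add_le.2 h2) (by positivity) (by positivity)
    nlinarith [mul_nonneg (sq_nonneg δ) hn, sq_nonneg δ]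
  have e4 : δ ^ 2 * ((n + 2).choose (j + 2) : ℝ) ≤ n.choose (j + 1) := by
    have hp : (0 : ℝ) < ((n : ℝ) + 2) * (n + 1) := by positivity
    refine le_of_mul_le_mul_left ?_ hp
    rw [e2]
    have := mul_le_mul_of_nonneg_left e3 (Nat.cast_nonneg (α := ℝ) ((n + 2).choose (j + 2)))
    linarith
  linarith

theorem abs_krawGen_coeff_le_pow {δ : ℝ} (hδ : 0 ≤ δ) (hδ1 : δ ≤ 1 / 2) {N : ℕ} (M : ℕ) :
    ∀ {n i j : ℕ}, M ≤ i → M + i ≤ n → n ≤ N → δ * N + 2 * M ≤ j → δ * N + 2 * M + j ≤ n →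
      |(krawGen n i).coeff j| ≤ (1 - 2 * δ ^ 2) ^ M * n.choose j := by
  have hq : 0 ≤ 1 - 2 * δ ^ 2 := by nlinarith
  have hN : 0 ≤ δ * N := by positivity
  induction M with
  | zero =>
    intro n i j _ hin _ _ _
    rw [pow_zero, one_mul, ← kraw_eq_coeff j (by omega), kraw]
    have h : ((n.choose j : ℕ) : ℝ) = ∑ l ∈ Finset.range (j + 1),
        (i.choose l : ℝ) * (n - i).choose (j - l) := by
      have := Nat.add_choose_eq i (n - i) j
      rw [Nat.add_sub_cancel' (by omega),
        Finset.Nat.sum_antidiagonal_eq_sum_range_succ_mk] at this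
      exact_mod_cast this
    rw [h]
    refine (Finset.abs_sum_le_sum_abs _ _).trans (Finset.sum_le_sum fun l _ => ?_)
    rw [← Nat.cast_sub (by omega), genChoose_natCast, genChoose_natCast]
    simp [abs_mul]
  | succ M ih =>
    intro n i j hMi hin hnN hj hjn
    push_cast at hj hjn
    obtain ⟨i, rfl⟩ : ∃ i', i = i' + 1 := ⟨i - 1, by omega⟩
    obtain ⟨n, rfl⟩ : ∃ n', n = n' + 2 := ⟨n - 2, by omega⟩
    have hM : (0 : ℝ) ≤ M := Nat.cast_nonneg M
    obtain ⟨j, rfl⟩ : ∃ j', j = j' + 2 := by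
      refine ⟨j - 2, ?_⟩
      have : (2 : ℝ) ≤ j := by linarith
      have : 2 ≤ j := by exact_mod_cast this
      omega
    push_cast at hj hjn
    have hnN' : (n : ℝ) + 2 ≤ N := by exact_mod_cast hnN
    have hδn := mul_le_mul_of_nonneg_left hnN' hδ
    rw [krawGen_coeff_add_two_add_two (by omega)]
    have i1 := ih (n := n) (i := i) (j := j + 2) (by omega) (by omega) (by omega)
      (by push_cast; linarith) (by push_cast; linarith)
    have i2 := ih (n := n) (i := i) (j := j) (by omega) (by omega) (by omega)
      (by linarith) (by linarith)
    have i3 := choose_add_choose_add_two_le (n := n) (j := j) hδ (by linarith) (by linarith)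
    calc _ ≤ _ := abs_sub _ _
      _ ≤ (1 - 2 * δ ^ 2) ^ M * ((n.choose (j + 2) : ℝ) + n.choose j) := by linarith
      _ ≤ (1 - 2 * δ ^ 2) ^ M * ((1 - 2 * δ ^ 2) * (n + 2).choose (j + 2)) := by gcongr
      _ = _ := by ring

/-- The values `K_j(i) / binom(n, j)` of the normalized Krawtchouk polynomial. -/
noncomputable def krawRatio (n j i : ℕ) : ℝ := (krawGen n i).coeff j / n.choose j

theorem krawRatio_zero {n j : ℕ} (hj : j ≤ n) : krawRatio n j 0 = 1 := by
  have : (n.choose j : ℝ) ≠ 0 := by exact_mod_cast (Nat.choose_pos hj).ne'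
  rw [krawRatio, krawGen_coeff_zero, div_self this]

theorem krawRatio_one {n j : ℕ} (hn : 1 ≤ n) (hj : j ≤ n) :
    krawRatio n j 1 = 1 - 2 * (j / n) := by
  have : (n.choose j : ℝ) ≠ 0 := by exact_mod_cast (Nat.choose_pos hj).ne'
  have hn' : (n : ℝ) ≠ 0 := by exact_mod_cast (by omega : n ≠ 0)
  rw [krawRatio, div_eq_iff this]
  refine mul_left_cancel₀ hn' ?_
  rw [krawGen_coeff_one hn]
  field_simp

theorem krawRatio_add_two {n i : ℕ} (hi : i + 2 ≤ n) (j : ℕ) :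
    (n - (i + 1)) * krawRatio n j (i + 2) =
      (n - 2 * j) * krawRatio n j (i + 1) - (i + 1) * krawRatio n j i := by
  simp only [krawRatio, ← mul_div_assoc, krawGen_coeff_add_two hi, sub_div]

theorem krawRatio_add_two_eq_div {n i : ℕ} (hi : i + 2 ≤ n) (j : ℕ) :
    krawRatio n j (i + 2) = ((1 - 2 * (j / n)) * krawRatio n j (i + 1)
      - (i + 1) * (1 / n) * krawRatio n j i) / (1 - (i + 1) * (1 / n)) := by
  have hn : (0 : ℝ) < n := by exact_mod_cast (by omega : 0 < n)
  have hi' : (i : ℝ) + 2 ≤ n := by exact_mod_cast hi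
  have h : (1 - ((i : ℝ) + 1) * (1 / n)) ≠ 0 := by
    have : (1 - ((i : ℝ) + 1) * (1 / n)) = (n - (i + 1)) / n := by field_simp
    rw [this]
    exact (div_pos (by linarith) hn).ne'
  rw [eq_div_iff h]
  refine mul_left_cancel₀ hn.ne' ?_
  have := krawRatio_add_two hi j
  have e : (n : ℝ) * (1 / n) = 1 := by field_simp
  have e' : (n : ℝ) * (j / n) = j := by field_simp
  linear_combination this - (i + 1) * krawRatio n j (i + 2) * e +
    (i + 1) * krawRatio n j i * e - (-2) * krawRatio n j (i + 1) * e'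

theorem krawRatio_sub {n i : ℕ} (hi : i ≤ n) (j : ℕ) :
    krawRatio n j (n - i) = (-1) ^ j * krawRatio n j i := by
  rw [krawRatio, krawGen_coeff_sub hi, krawRatio, mul_div_assoc]

theorem abs_krawRatio_le_of_le_sub {ρ : ℝ} {n j : ℕ} (hj : j ≤ n) (hnj : n ≤ 2 * j)
    (h3 : |krawRatio n j 3| ≤ ρ) (h4 : |krawRatio n j 4| ≤ ρ) {i : ℕ} (hi : 3 ≤ i) :
    i ≤ n → i ≤ n - j + 1 → |krawRatio n j i| ≤ ρ := by
  induction i using Nat.strong_induction_on with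
  | _ i ih =>
    intro hin hij
    rcases (by omega : i = 3 ∨ i = 4 ∨ 5 ≤ i) with rfl | rfl | h5
    · exact h3
    · exact h4
    obtain ⟨i, rfl⟩ : ∃ i', i = i' + 2 := ⟨i - 2, by omega⟩
    have a1 := ih (i + 1) (by omega) (by omega) (by omega) (by omega)
    have a0 := ih i (by omega) (by omega) (by omega) (by omega)
    have hin' : (i : ℝ) + 2 ≤ n := by exact_mod_cast hin
    have hij' : (i : ℝ) + 1 + j ≤ n := by exact_mod_cast (by omega : i + 1 + j ≤ n)
    have hnj' : (n : ℝ) ≤ 2 * j := by exact_mod_cast hnj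
    have hpos : (0 : ℝ) < n - (i + 1) := by linarith
    have hρ : 0 ≤ ρ := (abs_nonneg _).trans h3
    refine le_of_mul_le_mul_left ?_ hpos
    rw [← abs_of_pos hpos, ← abs_mul, krawRatio_add_two hin, abs_of_pos hpos]
    refine (abs_sub _ _).trans ?_
    rw [abs_mul, abs_mul, abs_of_nonpos (by linarith : (n : ℝ) - 2 * j ≤ 0),
      abs_of_nonneg (by positivity : (0 : ℝ) ≤ i + 1)]
    have b1 := mul_le_mul_of_nonneg_left a1 (by linarith : 0 ≤ -((n : ℝ) - 2 * j))
    have b0 := mul_le_mul_of_nonneg_left a0 (by positivity : (0 : ℝ) ≤ i + 1)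
    nlinarith

theorem abs_krawRatio_le {ρ δ : ℝ} {n j M : ℕ} (hδ : 0 ≤ δ) (hδ1 : δ ≤ 1 / 2)
    (hMρ : (1 - 2 * δ ^ 2) ^ M ≤ ρ) (hMj : δ * n + 2 * M ≤ j) (hMn : δ * n + 2 * M + j ≤ n)
    (hnj : n ≤ 2 * j) (h3 : |krawRatio n j 3| ≤ ρ) (h4 : |krawRatio n j 4| ≤ ρ) {i : ℕ}
    (hi : 3 ≤ i) (hin : i + 3 ≤ n) : |krawRatio n j i| ≤ ρ := by
  have hM : M + j ≤ n := by
    have : (0 : ℝ) ≤ δ * n := by positivity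
    have hM0 : (0 : ℝ) ≤ M := Nat.cast_nonneg M
    have : (M : ℝ) + j ≤ n := by linarith
    exact_mod_cast this
  by_cases hi1 : i ≤ n - j + 1
  · exact abs_krawRatio_le_of_le_sub (by omega) hnj h3 h4 hi (by omega) hi1
  by_cases hi2 : n - i ≤ n - j + 1
  · have := abs_krawRatio_le_of_le_sub (by omega) hnj h3 h4 (by omega : 3 ≤ n - i)
      (by omega) hi2
    rwa [krawRatio_sub (by omega), abs_mul, abs_neg_one_pow, one_mul] at this
  have hC : (0 : ℝ) < n.choose j := by exact_mod_cast Nat.choose_pos (by omega)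
  rw [krawRatio, abs_div, abs_of_pos hC, div_le_iff₀ hC]
  refine (abs_krawGen_coeff_le_pow hδ hδ1 M (by omega) (by omega) le_rfl hMj hMn).trans ?_
  gcongr

/-- The closed form of `krawRatio n j 2` in terms of `t = j / n` and `s = 1 / n`. -/
noncomputable def ratioTwo (t s : ℝ) : ℝ := ((1 - 2 * t) ^ 2 - s) / (1 - s)

/-- The closed form of `krawRatio n j 3` in terms of `t = j / n` and `s = 1 / n`. -/
noncomputable def ratioThree (t s : ℝ) : ℝ :=
  ((1 - 2 * t) * ratioTwo t s - 2 * s * (1 - 2 * t)) / (1 - 2 * s)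

/-- The closed form of `krawRatio n j 4` in terms of `t = j / n` and `s = 1 / n`. -/
noncomputable def ratioFour (t s : ℝ) : ℝ :=
  ((1 - 2 * t) * ratioThree t s - 3 * s * ratioTwo t s) / (1 - 3 * s)

theorem krawRatio_two {n j : ℕ} (hn : 2 ≤ n) (hj : j ≤ n) :
    krawRatio n j 2 = ratioTwo (j / n) (1 / n) := by
  rw [krawRatio_add_two_eq_div (i := 0) hn, krawRatio_zero hj, zero_add,
    krawRatio_one (by omega) hj, ratioTwo]
  norm_num [pow_two]

theorem krawRatio_three {n j : ℕ} (hn : 3 ≤ n) (hj : j ≤ n) :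
    krawRatio n j 3 = ratioThree (j / n) (1 / n) := by
  rw [krawRatio_add_two_eq_div (i := 1) hn, krawRatio_two (by omega) hj,
    krawRatio_one (by omega) hj, ratioThree]
  norm_num

theorem krawRatio_four {n j : ℕ} (hn : 4 ≤ n) (hj : j ≤ n) :
    krawRatio n j 4 = ratioFour (j / n) (1 / n) := by
  rw [krawRatio_add_two_eq_div (i := 2) hn, krawRatio_three (by omega) hj,
    krawRatio_two (by omega) hj, ratioFour]
  norm_num

/-- The common factor `2t - 1 + s(2t + 2s - 1)` of the denominators of `xStar`. -/
noncomputable def starDen (t s : ℝ) : ℝ := 2 * t - 1 + s * (2 * t + 2 * s - 1)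

/-- The weight `binom(n, k) x*_k` in terms of `t = k / n` and `s = 1 / n`. -/
noncomputable def starWeight (t s : ℝ) : ℝ :=
  (1 + 2 * (t + s) ^ 2 - 2 * (t + s) - s) / (2 * t * starDen t s)

/-- The weight `binom(n, k + 1) x*_{k+1}` in terms of `t = k / n` and `s = 1 / n`. -/
noncomputable def starWeight' (t s : ℝ) : ℝ := (1 - t) / starDen t s

theorem starWeight_identity_last {t s : ℝ} (ht : t ≠ 0) (hd : starDen t s ≠ 0) :
    (1 - 2 * t - 1) * starWeight t s + (1 - 2 * (t + s) + 1) * starWeight' t s = -1 := by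
  have h : starDen t s = 2 * t - 1 + s * (2 * t + 2 * s - 1) := rfl
  rw [starWeight, starWeight']
  field_simp
  rw [h]
  ring

theorem starWeight_identity_two {t s : ℝ} (ht : t ≠ 0) (hs : 1 - s ≠ 0)
    (hd : starDen t s ≠ 0) :
    (1 - 2 * t - ratioTwo t s) * starWeight t s +
      (1 - 2 * (t + s) - ratioTwo (t + s) s) * starWeight' t s = -1 := by
  have h : starDen t s = 2 * t - 1 + s * (2 * t + 2 * s - 1) := rfl
  rw [starWeight, starWeight', ratioTwo, ratioTwo]
  field_simp
  rw [h]
  ring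

theorem xStar_self {β : ℝ} {n k : ℕ} (hk : k = 2 * ⌊β * n / 2⌋₊) :
    xStar β n k = starWeight (k / n) (1 / n) / n.choose k := by
  simp only [xStar, ← hk, if_true, starWeight, starDen]
  rw [div_div]
  congr 1
  ring

theorem xStar_succ {β : ℝ} {n k : ℕ} (hk : k = 2 * ⌊β * n / 2⌋₊) :
    xStar β n (k + 1) = starWeight' (k / n) (1 / n) / n.choose (k + 1) := by
  simp only [xStar, ← hk, starWeight', starDen]
  rw [if_neg (by omega), if_true, div_div]
  congr 1
  ring

theorem xStar_of_ne {β : ℝ} {n k j : ℕ} (hk : k = 2 * ⌊β * n / 2⌋₊) (h : j ≠ k)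
    (h' : j ≠ k + 1) : xStar β n j = 0 := by
  simp only [xStar, ← hk, if_neg h, if_neg h']

theorem sum_kraw_mul_xStar {β : ℝ} {n k i : ℕ} (hk : k = 2 * ⌊β * n / 2⌋₊) (hk1 : 1 ≤ k)
    (hkn : k + 1 ≤ n) (hi : i ≤ n) :
    ∑ j ∈ Finset.Icc 1 n, (kraw n j 1 - kraw n j (i : ℝ)) * xStar β n j =
      (krawRatio n k 1 - krawRatio n k i) * starWeight (k / n) (1 / n) +
      (krawRatio n (k + 1) 1 - krawRatio n (k + 1) i) * starWeight' (k / n) (1 / n) := by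
  rw [Finset.sum_eq_add_of_mem k (k + 1) (by simp; omega) (by simp; omega) (by omega)
    fun j _ hj => by rw [xStar_of_ne hk hj.1 hj.2, mul_zero]]
  have e : ∀ j, kraw n j 1 = (krawGen n 1).coeff j := fun j => by
    rw [← kraw_eq_coeff j (by omega), Nat.cast_one]
  rw [xStar_self hk, xStar_succ hk, e, e, kraw_eq_coeff k hi, kraw_eq_coeff (k + 1) hi]
  simp only [krawRatio]
  ring

/-- The inequalities on `t = k / n` and `s = 1 / n` which make `x*` feasible. -/
structure StarRegime (ρ δ : ℝ) (M : ℕ) (t s : ℝ) : Prop where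
  weight_nonneg : 0 ≤ starWeight t s
  weight'_nonneg : 0 ≤ starWeight' t s
  den_pos : 0 < starDen t s
  half_lt : 1 / 2 < t
  s_lt : s < 1 / 6
  lower : δ + 2 * M * s < t
  upper : δ + 2 * M * s + (t + s) < 1
  three : |ratioThree t s| < ρ
  three' : |ratioThree (t + s) s| < ρ
  four : |ratioFour t s| < ρ
  four' : |ratioFour (t + s) s| < ρ
  two : 0 < ratioTwo (t + s) s
  penultimate : -1 < 2 * (1 - 2 * (t + s)) * starWeight' t s
  middle : -1 < (1 - 2 * t) * starWeight t s + (1 - 2 * (t + s)) * starWeight' t s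
    - (starWeight t s + starWeight' t s) * ρ

theorem StarRegime.feasible {ρ δ β : ℝ} {M n k : ℕ} (hk : k = 2 * ⌊β * n / 2⌋₊) (hn : 0 < n)
    (hδ : 0 ≤ δ) (hδ1 : δ ≤ 1 / 2) (hMρ : (1 - 2 * δ ^ 2) ^ M ≤ ρ)
    (H : StarRegime ρ δ M (k / n) (1 / n)) :
    (∀ j ∈ Finset.Icc 1 n, 0 ≤ xStar β n j) ∧
      ∀ i ∈ Finset.Icc 2 n,
        -1 ≤ ∑ j ∈ Finset.Icc 1 n, (kraw n j 1 - kraw n j (i : ℝ)) * xStar β n j := by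
  have hn' : (0 : ℝ) < n := by exact_mod_cast hn
  have hs0 : (0 : ℝ) < 1 / n := by positivity
  have hn6 : 6 < n := by
    have := H.s_lt
    rw [one_div_lt_one_div hn' (by norm_num)] at this
    exact_mod_cast this
  have hnk : n < 2 * k := by
    have := H.half_lt
    rw [lt_div_iff₀ hn'] at this
    have : (n : ℝ) < 2 * k := by linarith
    exact_mod_cast this
  have hδn : 0 ≤ δ * n := by positivity
  have hM0 : (0 : ℝ) ≤ M := Nat.cast_nonneg M
  have hlow : δ * n + 2 * M < k := by
    have := mul_lt_mul_of_pos_right H.lower hn'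
    field_simp at this
    linarith
  have hup : δ * n + 2 * M + (k + 1) < n := by
    have := mul_lt_mul_of_pos_right H.upper hn'
    field_simp at this
    linarith
  have hkn : k + 1 ≤ n := by
    have : (k : ℝ) + 1 ≤ n := by linarith
    exact_mod_cast this
  have hks : ((k + 1 : ℕ) : ℝ) / n = k / n + 1 / n := by push_cast; ring
  have ha := H.weight_nonneg
  have hb := H.weight'_nonneg
  have ht0 : (k : ℝ) / n ≠ 0 := by linarith [H.half_lt]
  refine ⟨fun j _ => ?_, fun i hi => ?_⟩
  · by_cases h1 : j = k
    · rw [h1, xStar_self hk]; positivity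
    by_cases h2 : j = k + 1
    · rw [h2, xStar_succ hk]; positivity
    · rw [xStar_of_ne hk h1 h2]
  obtain ⟨hi2, hin⟩ := Finset.mem_Icc.1 hi
  have hev : Even k := hk ▸ even_two_mul _
  have c1 := krawRatio_one hn (by omega : k ≤ n)
  have d1 := krawRatio_one hn hkn
  have c2 := krawRatio_two (by omega) (by omega : k ≤ n)
  have d2 := krawRatio_two (by omega) hkn
  have cr : ∀ l ≤ n, krawRatio n k (n - l) = krawRatio n k l := fun l hl => by
    rw [krawRatio_sub hl, hev.neg_one_pow, one_mul]
  have dr : ∀ l ≤ n, krawRatio n (k + 1) (n - l) = -krawRatio n (k + 1) l := fun l hl => by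
    rw [krawRatio_sub hl, hev.add_one.neg_one_pow, neg_one_mul]
  have id2 := starWeight_identity_two ht0 (by linarith [H.s_lt]) H.den_pos.ne'
  have idn := starWeight_identity_last ht0 H.den_pos.ne'
  rw [hks] at d1 d2
  rw [sum_kraw_mul_xStar hk (by omega) hkn hin, c1, d1]
  rcases (by omega : i = 2 ∨ i = n ∨ i = n - 1 ∨ i = n - 2 ∨ (3 ≤ i ∧ i + 3 ≤ n)) with
    rfl | rfl | rfl | rfl | ⟨hi3, hin3⟩
  · rw [c2, d2, id2]
  · have cn := cr 0 (by omega)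
    have dn := dr 0 (by omega)
    rw [Nat.sub_zero] at cn dn
    rw [cn, dn, krawRatio_zero (by omega), krawRatio_zero hkn, sub_neg_eq_add, idn]
  · rw [cr 1 (by omega), dr 1 (by omega), c1, d1]
    linarith [H.penultimate]
  · rw [cr 2 (by omega), dr 2 (by omega), c2, d2]
    linarith [mul_nonneg H.two.le hb]
  · have A := abs_krawRatio_le hδ hδ1 hMρ hlow.le (by linarith) hnk.le
      (by rw [krawRatio_three (by omega) (by omega)]; exact H.three.le)
      (by rw [krawRatio_four (by omega) (by omega)]; exact H.four.le) hi3 hin3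
    have B := abs_krawRatio_le (j := k + 1) hδ hδ1 hMρ (by push_cast; linarith)
      (by push_cast; linarith) (by omega)
      (by rw [krawRatio_three (by omega) hkn, hks]; exact H.three'.le)
      (by rw [krawRatio_four (by omega) hkn, hks]; exact H.four'.le) hi3 hin3
    have A' := mul_le_mul_of_nonneg_right ((le_abs_self _).trans A) ha
    have B' := mul_le_mul_of_nonneg_right ((le_abs_self _).trans B) hb
    linarith [H.middle]

section Limit

open Filter Topology

theorem eventually_starRegime {β ρ δ : ℝ} (hβ : 1 / 2 < β) (hβ1 : β < 1) (hδ : δ < 1 - β)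
    (hρ3 : (2 * β - 1) ^ 3 < ρ) (hρ2 : ρ < (2 * β - 1) ^ 2) (M : ℕ) :
    ∀ᶠ p in 𝓝 (β, (0 : ℝ)), StarRegime ρ δ M p.1 p.2 := by
  have hφ : 0 < 2 * β - 1 := by linarith
  have hd0 : starDen β 0 = 2 * β - 1 := by simp [starDen]
  have ha0 : starWeight β 0 = (1 + 2 * β ^ 2 - 2 * β) / (2 * β * (2 * β - 1)) := by
    simp [starWeight, hd0]
  have hb0 : starWeight' β 0 = (1 - β) / (2 * β - 1) := by simp [starWeight', hd0]
  have h20 : ratioTwo β 0 = (2 * β - 1) ^ 2 := by simp [ratioTwo]; ring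
  have h30 : ratioThree β 0 = -(2 * β - 1) ^ 3 := by simp [ratioThree, h20]; ring
  have h40 : ratioFour β 0 = (2 * β - 1) ^ 4 := by simp [ratioFour, h30]; ring
  have ht : ContinuousAt (fun p : ℝ × ℝ => p.1) (β, 0) := by fun_prop
  have hs : ContinuousAt (fun p : ℝ × ℝ => p.2) (β, 0) := by fun_prop
  have hts : ContinuousAt (fun p : ℝ × ℝ => (p.1 + p.2, p.2)) (β, 0) := by fun_prop
  have hshift {f : ℝ → ℝ → ℝ} (hf : ContinuousAt (fun p : ℝ × ℝ => f p.1 p.2) (β, 0)) :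
      ContinuousAt (fun p : ℝ × ℝ => f (p.1 + p.2) p.2) (β, 0) :=
    ContinuousAt.comp (f := fun p : ℝ × ℝ => (p.1 + p.2, p.2))
      (g := fun p : ℝ × ℝ => f p.1 p.2) (by simpa using hf) hts
  have hd : ContinuousAt (fun p : ℝ × ℝ => starDen p.1 p.2) (β, 0) := by
    unfold starDen; fun_prop
  have ha : ContinuousAt (fun p : ℝ × ℝ => starWeight p.1 p.2) (β, 0) := by
    unfold starWeight
    refine ContinuousAt.div (by fun_prop) (by fun_prop) ?_
    simp only [hd0]
    positivity
  have hb : ContinuousAt (fun p : ℝ × ℝ => starWeight' p.1 p.2) (β, 0) := by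
    unfold starWeight'
    exact ContinuousAt.div (by fun_prop) hd (by simp only [hd0]; positivity)
  have h2 : ContinuousAt (fun p : ℝ × ℝ => ratioTwo p.1 p.2) (β, 0) := by
    unfold ratioTwo
    exact ContinuousAt.div (by fun_prop) (by fun_prop) (by norm_num)
  have h3 : ContinuousAt (fun p : ℝ × ℝ => ratioThree p.1 p.2) (β, 0) := by
    unfold ratioThree
    exact ContinuousAt.div (by fun_prop) (by fun_prop) (by norm_num)
  have h4 : ContinuousAt (fun p : ℝ × ℝ => ratioFour p.1 p.2) (β, 0) := by
    unfold ratioFour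
    exact ContinuousAt.div (by fun_prop) (by fun_prop) (by norm_num)
  have h2' := hshift h2
  have h3' := hshift h3
  have h4' := hshift h4
  have hφ43 : (2 * β - 1) ^ 4 ≤ (2 * β - 1) ^ 3 :=
    pow_le_pow_of_le_one hφ.le (by linarith) (by norm_num)
  have b3 : |ratioThree β 0| < ρ := by rwa [h30, abs_neg, abs_of_pos (by positivity)]
  have b4 : |ratioFour β 0| < ρ := by rw [h40, abs_of_pos (by positivity)]; linarith
  have hsum : starWeight β 0 + starWeight' β 0 = 1 / (2 * β * (2 * β - 1)) := by
    rw [ha0, hb0]; field_simp; ring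
  filter_upwards [
    continuousAt_const.eventually_lt ha (by
      change (0 : ℝ) < starWeight β 0
      rw [ha0]; exact div_pos (by nlinarith) (by positivity)),
    continuousAt_const.eventually_lt hb (by
      change (0 : ℝ) < starWeight' β 0
      rw [hb0]; exact div_pos (by linarith) hφ),
    continuousAt_const.eventually_lt hd (by change (0 : ℝ) < starDen β 0; rwa [hd0]),
    continuousAt_const.eventually_lt ht hβ,
    hs.eventually_lt (continuousAt_const (y := (1 / 6 : ℝ))) (by norm_num),
    (show ContinuousAt (fun p : ℝ × ℝ => δ + 2 * M * p.2) (β, 0) by fun_prop).eventually_lt ht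
      (by simp; linarith),
    (show ContinuousAt (fun p : ℝ × ℝ => δ + 2 * M * p.2 + (p.1 + p.2)) (β, 0) by
      fun_prop).eventually_lt (continuousAt_const (y := (1 : ℝ))) (by simp; linarith),
    h3.abs.eventually_lt (continuousAt_const (y := ρ)) b3,
    h3'.abs.eventually_lt (continuousAt_const (y := ρ)) (by simpa using b3),
    h4.abs.eventually_lt (continuousAt_const (y := ρ)) b4,
    h4'.abs.eventually_lt (continuousAt_const (y := ρ)) (by simpa using b4),
    continuousAt_const.eventually_lt h2' (by
      change (0 : ℝ) < ratioTwo (β + 0) 0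
      rw [add_zero, h20]; positivity),
    continuousAt_const.eventually_lt
      (show ContinuousAt (fun p : ℝ × ℝ => 2 * (1 - 2 * (p.1 + p.2)) * starWeight' p.1 p.2)
        (β, 0) by fun_prop) (by
      change (-1 : ℝ) < 2 * (1 - 2 * (β + 0)) * starWeight' β 0
      rw [hb0, show 2 * (1 - 2 * (β + 0)) * ((1 - β) / (2 * β - 1)) = -2 * (1 - β) by
        field_simp; ring]
      linarith),
    continuousAt_const.eventually_lt
      (show ContinuousAt (fun p : ℝ × ℝ => (1 - 2 * p.1) * starWeight p.1 p.2
        + (1 - 2 * (p.1 + p.2)) * starWeight' p.1 p.2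
        - (starWeight p.1 p.2 + starWeight' p.1 p.2) * ρ) (β, 0) by fun_prop) (by
      change (-1 : ℝ) < (1 - 2 * β) * starWeight β 0 + (1 - 2 * (β + 0)) * starWeight' β 0
        - (starWeight β 0 + starWeight' β 0) * ρ
      rw [show (1 - 2 * β) * starWeight β 0 + (1 - 2 * (β + 0)) * starWeight' β 0
        - (starWeight β 0 + starWeight' β 0) * ρ =
        -((2 * β - 1 + ρ) * (starWeight β 0 + starWeight' β 0)) by ring, hsum,
        neg_lt_neg_iff, mul_one_div, div_lt_one (by positivity)]
      nlinarith)]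
    with p p1 p2 p3 p4 p5 p6 p7 p8 p9 p10 p11 p12 p13 p14
  exact ⟨p1.le, p2.le, p3, p4, p5, p6, p7, p8, p9, p10, p11, p12, p13, p14⟩

theorem tendsto_two_mul_floor_div {β : ℝ} (hβ : 0 ≤ β) :
    Tendsto (fun n : ℕ => (((2 * ⌊β * n / 2⌋₊ : ℕ) : ℝ) / n, (1 : ℝ) / n)) atTop
      (𝓝 (β, 0)) := by
  refine Tendsto.prodMk_nhds ?_ tendsto_one_div_atTop_nhds_zero_nat
  have h := ((tendsto_nat_floor_mul_div_atTop (R := ℝ) (a := β / 2) (by positivity)).comp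
    tendsto_natCast_atTop_atTop).const_mul 2
  rw [show 2 * (β / 2) = β by ring] at h
  refine h.congr fun n => ?_
  simp only [Function.comp_apply]
  rw [show β / 2 * n = β * n / 2 by ring]
  push_cast
  ring

end Limit

end KrawGen

theorem xStar_feasible (β : ℝ) (hβ : 1 / 2 < β) (hβ1 : β < 1) :
    ∃ N : ℕ, 0 < N ∧ ∀ n : ℕ, N ≤ n →
      (∀ j ∈ Finset.Icc 1 n, 0 ≤ xStar β n j) ∧
      (∀ i ∈ Finset.Icc 2 n,
        -1 ≤ ∑ j ∈ Finset.Icc 1 n, (kraw n j 1 - kraw n j (i : ℝ)) * xStar β n j) := by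
  have hφ : 0 < 2 * β - 1 := by linarith
  obtain ⟨ρ, hρ3, hρ2⟩ : ∃ ρ, (2 * β - 1) ^ 3 < ρ ∧ ρ < (2 * β - 1) ^ 2 :=
    exists_between (pow_lt_pow_right_of_lt_one₀ hφ (by linarith) (by norm_num))
  have hρ : 0 < ρ := lt_trans (by positivity) hρ3
  have hδ : 0 < (1 - β) / 2 := by linarith
  obtain ⟨M, hM⟩ : ∃ M : ℕ, (1 - 2 * ((1 - β) / 2) ^ 2) ^ M < ρ :=
    exists_pow_lt_of_lt_one hρ (by nlinarith)
  have h := (tendsto_two_mul_floor_div (by linarith)).eventually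
    (eventually_starRegime hβ hβ1 (δ := (1 - β) / 2) (by linarith) hρ3 hρ2 M)
  obtain ⟨N, hN⟩ := Filter.eventually_atTop.1 h
  refine ⟨N + 1, by omega, fun n hn => ?_⟩
  exact (hN n (by omega)).feasible rfl (by omega) hδ.le (by linarith) hM.le
end

section
/- For every real number a with 0 < a ≤ 1/2, the supremum over β ∈ (1/2, 1) of −[1 + (1−2β)(1/a − 1)] / (2β(2β−1)) equals θ(a). -/
/-- `θ(a) = (1−√a)²/a` for `0 < a < 1/4` and `θ(a) = 1/(2a) − 1` for `1/4 ≤ a ≤ 1/2`. -/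
noncomputable def theta (a : ℝ) : ℝ :=
  if a < 1 / 4 then (1 - Real.sqrt a) ^ 2 / a else 1 / (2 * a) - 1

theorem isGreatest_of_lt_quarter {s : ℝ} (hs0 : 0 < s) (hs : s < 1 / 2) :
    IsGreatest {v : ℝ | ∃ β : ℝ, 1 / 2 < β ∧ β < 1 ∧
      v = -(1 + (1 - 2 * β) * (1 / s ^ 2 - 1)) / (2 * β * (2 * β - 1))}
      ((1 - s) ^ 2 / s ^ 2) := by
  have h1 : 0 < 1 - s := by linarith
  constructor
  · refine ⟨1 / (2 * (1 - s)), ?_, ?_, ?_⟩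
    · rw [div_lt_div_iff₀ (by norm_num) (by linarith)]; linarith
    · rw [div_lt_one (by linarith)]; linarith
    · have h2 : 2 * (1 / (2 * (1 - s))) = 1 / (1 - s) := by field_simp
      have h3 : 1 / (1 - s) - 1 = s / (1 - s) := by field_simp; ring
      have h4 : 1 - 1 / (1 - s) = -(s / (1 - s)) := by rw [← h3]; ring
      rw [h2, h3, h4]
      field_simp
      ring
  · rintro v ⟨β, hβ, hβ1, rfl⟩
    have hu : 0 < 2 * β - 1 := by linarith
    have hb : 0 < 2 * β := by linarith
    rw [div_le_iff₀ (mul_pos hb hu)]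
    have key : (1 - s) ^ 2 / s ^ 2 * (2 * β * (2 * β - 1))
        - -(1 + (1 - 2 * β) * (1 / s ^ 2 - 1)) = ((1 - s) / s * (2 * β - 1) - 1) ^ 2 := by
      field_simp
      ring
    nlinarith [sq_nonneg ((1 - s) / s * (2 * β - 1) - 1)]

theorem isLUB_of_slope_le_one {M : ℝ} (hM0 : 0 ≤ M) (hM1 : M ≤ 1) :
    IsLUB {v : ℝ | ∃ β : ℝ, 1 / 2 < β ∧ β < 1 ∧
      v = -(1 + (1 - 2 * β) * (2 * M + 1)) / (2 * β * (2 * β - 1))} M := by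
  constructor
  · rintro v ⟨β, hβ, hβ1, rfl⟩
    have hu : 0 < 2 * β - 1 := by linarith
    have hb : 0 < 2 * β := by linarith
    rw [div_le_iff₀ (mul_pos hb hu)]
    have h : M * (2 * β - 1) ≤ 1 := by nlinarith
    nlinarith [mul_nonneg (sub_nonneg.2 h) (sub_nonneg.2 hβ1.le)]
  · intro w hw
    by_contra! hlt
    obtain ⟨d, hd0, hd1, hd2⟩ : ∃ d : ℝ, 0 < d ∧ d ≤ 1 / 2 ∧ 2 * d ≤ M - w :=
      ⟨min (1 / 2) ((M - w) / 2), lt_min (by norm_num) (by linarith), min_le_left _ _, by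
        linarith [min_le_right (1 / 2) ((M - w) / 2)]⟩
    have h := hw ⟨1 - d / 2, by linarith, by linarith, rfl⟩
    have hu : 0 < 2 * (1 - d / 2) - 1 := by linarith
    have hb : 0 < 2 * (1 - d / 2) := by linarith
    rw [div_le_iff₀ (mul_pos hb hu)] at h
    have hp : 3 / 4 ≤ 2 * (1 - d / 2) * (2 * (1 - d / 2) - 1) := by nlinarith
    have hq := mul_le_mul hd2 hp (by norm_num) (by linarith)
    nlinarith [mul_nonneg (mul_nonneg hM0 hd0.le) hu.le]

theorem sup_over_beta_eq_theta (a : ℝ) (ha0 : 0 < a) (ha : a ≤ 1 / 2) :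
    sSup {v : ℝ | ∃ β : ℝ, 1 / 2 < β ∧ β < 1 ∧
      v = -(1 + (1 - 2 * β) * (1 / a - 1)) / (2 * β * (2 * β - 1))} = theta a := by
  unfold theta
  split_ifs with h
  · have hs : √a < 1 / 2 := by
      rw [Real.sqrt_lt' (by norm_num)]
      linarith
    have := (isGreatest_of_lt_quarter (Real.sqrt_pos.2 ha0) hs).csSup_eq
    rwa [Real.sq_sqrt ha0.le] at this
  · have hM0 : 0 ≤ 1 / (2 * a) - 1 := by
      rw [sub_nonneg, le_div_iff₀ (by linarith)]
      linarith
    have hM1 : 1 / (2 * a) - 1 ≤ 1 := by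
      rw [sub_le_iff_le_add, div_le_iff₀ (by linarith)]
      linarith
    have hk : 1 / a - 1 = 2 * (1 / (2 * a) - 1) + 1 := by
      field_simp
      ring
    rw [hk]
    exact (isLUB_of_slope_le_one hM0 hM1).csSup_eq ⟨_, 3 / 4, by norm_num, by norm_num, rfl⟩
end
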